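/- In M_q(n), for any subsets K, L of {1,...,n} of equal cardinality, the multiplicative set generated by the quantum minor D^K_L and 1 is a (two-sided) Ore set: it satisfies both the left and right Ore conditions in M_q(n). -/

import Mathlib

open scoped BigOperators

/-- The defining relations of the quantum matrix bialgebra `M_q(n)`. -/
inductive QMatRel (k : Type*) [Field k] (q : k) (n : ℕ) :
    FreeAlgebra k (Fin n × Fin n) → FreeAlgebra k (Fin n × Fin n) → Prop
  | row (a : Fin n) {c d : Fin n} (h : c < d) :
      QMatRel k q n (FreeAlgebra.ι k (a, c) * FreeAlgebra.ι k (a, d))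
        (q • (FreeAlgebra.ι k (a, d) * FreeAlgebra.ι k (a, c)))
  | col {a b : Fin n} (c : Fin n) (h : a < b) :
      QMatRel k q n (FreeAlgebra.ι k (a, c) * FreeAlgebra.ι k (b, c))
        (q • (FreeAlgebra.ι k (b, c) * FreeAlgebra.ι k (a, c)))
  | cross1 {a b c d : Fin n} (hab : a < b) (hcd : c < d) :
      QMatRel k q n (FreeAlgebra.ι k (a, c) * FreeAlgebra.ι k (b, d))
        (FreeAlgebra.ι k (b, d) * FreeAlgebra.ι k (a, c) +
          (q - q⁻¹) • (FreeAlgebra.ι k (b, c) * FreeAlgebra.ι k (a, d)))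
  | cross2 {a b c d : Fin n} (hab : a < b) (hdc : d < c) :
      QMatRel k q n (FreeAlgebra.ι k (a, c) * FreeAlgebra.ι k (b, d))
        (FreeAlgebra.ι k (b, d) * FreeAlgebra.ι k (a, c))

/-- The quantum matrix algebra `M_q(n)`. -/
abbrev QMat (k : Type*) [Field k] (q : k) (n : ℕ) : Type _ := RingQuot (QMatRel k q n)

/-- The generator `t^i_j` of `M_q(n)`. -/
noncomputable def tgen {k : Type*} [Field k] (q : k) (n : ℕ) (i j : Fin n) : QMat k q n :=
  RingQuot.mkAlgHom k (QMatRel k q n) (FreeAlgebra.ι k (i, j))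

/-- Number of inversions of a permutation of `Fin m`. -/
def invCount {m : ℕ} (σ : Equiv.Perm (Fin m)) : ℕ :=
  (Finset.univ.filter (fun p : Fin m × Fin m => p.1 < p.2 ∧ σ p.2 < σ p.1)).card

/-- The quantum minor `D^K_L` with row set `K` and column set `L` (both of
cardinality `m`, taken in increasing order). -/
noncomputable def qMinor {k : Type*} [Field k] (q : k) {n : ℕ} (m : ℕ)
    (K L : Finset (Fin n)) (hK : K.card = m) (hL : L.card = m) : QMat k q n :=
  ∑ σ : Equiv.Perm (Fin m), ((-q) ^ invCount σ) •
    (List.ofFn (fun i : Fin m =>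
      tgen q n (K.orderIsoOfFin hK i) (L.orderIsoOfFin hL (σ i)))).prod

/-- A matrix `t` over a `k`-algebra satisfies the quantum matrix relations. -/
structure IsQuantumMatrix {k R : Type*} [Field k] [Ring R] [Algebra k R] (q : k) {n : ℕ}
    (t : Fin n → Fin n → R) : Prop where
  row (a : Fin n) {c d : Fin n} (h : c < d) : t a c * t a d = q • (t a d * t a c)
  col {a b : Fin n} (c : Fin n) (h : a < b) : t a c * t b c = q • (t b c * t a c)
  cross1 {a b c d : Fin n} (hab : a < b) (hcd : c < d) :
    t a c * t b d = t b d * t a c + (q - q⁻¹) • (t b c * t a d)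
  cross2 {a b c d : Fin n} (hab : a < b) (hdc : d < c) : t a c * t b d = t b d * t a c

namespace IsQuantumMatrix

section

variable {k R : Type*} [Field k] [Ring R] [Algebra k R] {q : k} {n : ℕ} {t : Fin n → Fin n → R}

theorem transpose (ht : IsQuantumMatrix q t) : IsQuantumMatrix q (fun i j => t j i) where
  row a _ _ h := ht.col a h
  col c h := ht.row c h
  cross1 hab hcd := by
    rw [ht.cross1 hcd hab, ht.cross2 hcd hab]
  cross2 hab hdc := (ht.cross2 hdc hab).symm

/-- The quantum matrix relations in `RTT` form. -/
theorem rtt (ht : IsQuantumMatrix q t) (hq : q ≠ 0) (a c b j : Fin n) :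
    (if b = j then q⁻¹ else 1) • (t a b * t c j) -
        (if b < j then q - q⁻¹ else 0) • (t a j * t c b) =
      (if a = c then q⁻¹ else 1) • (t c j * t a b) -
        (if c < a then q - q⁻¹ else 0) • (t a j * t c b) := by
  rcases lt_trichotomy a c with hac | rfl | hac <;> rcases lt_trichotomy b j with hbj | rfl | hbj
  · simp [hac.ne, hbj.ne, hac.not_gt, hbj, ht.cross1 hac hbj, ht.cross2 hac hbj]
  · simp [hac.ne, hac.not_gt, ht.col b hac, smul_smul, hq]
  · simp [hac.ne, hbj.ne', hac.not_gt, hbj.not_gt, ht.cross2 hac hbj]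
  · simp [hbj.ne, hbj, ht.row a hbj, ← sub_smul]
  · simp
  · simp [hbj.ne', hbj.not_gt, ht.row a hbj, smul_smul, hq]
  · simp [hac.ne', hbj.ne, hac, hbj, ht.cross2 hac hbj]
  · simp [hac.ne', hac, ht.col b hac, ← sub_smul]
  · simp [hac.ne', hbj.ne', hac, hbj.not_gt, ht.cross1 hac hbj]

end

end IsQuantumMatrix

/-- The weight `(-q) ^ #{s ∈ S | s < j}`. -/
def inversionWeight {k : Type*} [Field k] (q : k) {n : ℕ} (j : Fin n) (S : Finset (Fin n)) : k :=
  (-q) ^ (S.filter (· < j)).card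

section

variable {k : Type*} [Field k] {q : k} {n : ℕ}

theorem inversionWeight_ne_zero (hq : q ≠ 0) (j : Fin n) (S : Finset (Fin n)) :
    inversionWeight q j S ≠ 0 :=
  pow_ne_zero _ (neg_ne_zero.2 hq)

theorem inversionWeight_insert {i : Fin n} {S : Finset (Fin n)} (hi : i ∉ S) (j : Fin n) :
    inversionWeight q j (insert i S) = inversionWeight q j S * (if i < j then -q else 1) := by
  unfold inversionWeight
  rw [Finset.filter_insert]
  split_ifs with h
  · rw [Finset.card_insert_of_notMem (by simp [hi]), pow_succ]
  · simp

theorem inversionWeight_erase (hq : q ≠ 0) {i : Fin n} {S : Finset (Fin n)} (hi : i ∈ S)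
    (j : Fin n) :
    inversionWeight q j (S.erase i) = inversionWeight q j S * (if i < j then (-q)⁻¹ else 1) := by
  have h := inversionWeight_insert (q := q) (Finset.notMem_erase i S) j
  rw [Finset.insert_erase hi] at h
  rw [h]
  split_ifs <;> simp [hq]

theorem inversionWeight_eq_one {j : Fin n} {S : Finset (Fin n)} (h : ∀ s ∈ S, j ≤ s) :
    inversionWeight q j S = 1 := by
  unfold inversionWeight
  rw [Finset.filter_eq_empty_iff.2 fun s hs => (h s hs).not_gt]
  simp

end

section

variable {k : Type*} [Field k] (q : k) {n : ℕ} (R : Type*) [Ring R] [Algebra k R]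

/-- Left multiplication by the generator `ξ_j` on the quantum exterior algebra over `R`, whose
elements are given by their coefficients. -/
def exteriorMul (j : Fin n) : (Finset (Fin n) → R) →ₗ[R] (Finset (Fin n) → R) where
  toFun f S := if j ∈ S then inversionWeight q j S • f (S.erase j) else 0
  map_add' f g := by
    ext S
    by_cases h : j ∈ S <;> simp [h]
  map_smul' r f := by
    ext S
    by_cases h : j ∈ S <;> simp [h]

/-- The braiding of a vector `x_b` past the quantum exterior algebra: the component of
`x_b * f` at `x_d`. -/
def exteriorBraid (b d : Fin n) : (Finset (Fin n) → R) →ₗ[R] (Finset (Fin n) → R) where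
  toFun f S :=
    if b = d then (if d ∈ S then q⁻¹ else 1) • f S
    else if d < b ∧ b ∈ S ∧ d ∉ S then
      (-(q - q⁻¹) * inversionWeight q b S * (inversionWeight q d S)⁻¹) •
        f (insert d (S.erase b))
    else 0
  map_add' f g := by
    ext S
    simp only [Pi.add_apply, smul_add]
    split_ifs <;> simp
  map_smul' r f := by
    ext S
    simp only [Pi.smul_apply, RingHom.id_apply, smul_eq_mul]
    split_ifs <;> simp

variable {q R}

theorem exteriorMul_apply (j : Fin n) (f : Finset (Fin n) → R) (S : Finset (Fin n)) :
    exteriorMul q R j f S = if j ∈ S then inversionWeight q j S • f (S.erase j) else 0 := rfl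

theorem exteriorBraid_apply (b d : Fin n) (f : Finset (Fin n) → R) (S : Finset (Fin n)) :
    exteriorBraid q R b d f S =
      if b = d then (if d ∈ S then q⁻¹ else 1) • f S
      else if d < b ∧ b ∈ S ∧ d ∉ S then
        (-(q - q⁻¹) * inversionWeight q b S * (inversionWeight q d S)⁻¹) •
          f (insert d (S.erase b))
      else 0 := rfl

theorem exteriorMul_mul_self (j : Fin n) (f : Finset (Fin n) → R) :
    exteriorMul q R j (exteriorMul q R j f) = 0 := by
  ext S
  simp [exteriorMul_apply]

theorem exteriorMul_mul_comm (hq : q ≠ 0) {i j : Fin n} (h : i < j) (f : Finset (Fin n) → R) :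
    exteriorMul q R j (exteriorMul q R i f) = -q • exteriorMul q R i (exteriorMul q R j f) := by
  ext S
  by_cases hi : i ∈ S <;> by_cases hj : j ∈ S <;>
    simp [exteriorMul_apply, hi, hj, h.ne, h.ne', inversionWeight_erase hq, h, h.not_gt,
      smul_smul, Finset.erase_right_comm (a := i) (b := j)]
  congr 1
  field_simp

theorem exteriorBraid_exteriorMul (hq : q ≠ 0) (b d j : Fin n) (f : Finset (Fin n) → R) :
    exteriorBraid q R b d (exteriorMul q R j f) =
      (if b = j then q⁻¹ else 1 : k) • exteriorMul q R j (exteriorBraid q R b d f) -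
        (if j < b then q - q⁻¹ else 0 : k) • exteriorMul q R b (exteriorBraid q R j d f) := by
  ext S
  simp only [Pi.sub_apply, Pi.smul_apply]
  have hd := inversionWeight_ne_zero hq d S
  rcases eq_or_ne b d with rfl | hbd
  · rcases lt_trichotomy j b with hj | rfl | hj
    · by_cases h1 : j ∈ S <;> by_cases h2 : b ∈ S <;>
        simp [exteriorMul_apply, exteriorBraid_apply, h1, h2, hj.ne, hj.ne', hj.not_gt,
          smul_smul, mul_comm]
    · by_cases h1 : j ∈ S <;>
        simp [exteriorMul_apply, exteriorBraid_apply, h1, smul_smul]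
    · by_cases h1 : j ∈ S <;> by_cases h2 : b ∈ S <;>
        simp [exteriorMul_apply, exteriorBraid_apply, h1, h2, hj.ne, hj.ne', hj.not_gt,
          smul_smul, mul_comm]
  rcases hbd.lt_or_gt with hlt | hlt
  · rcases eq_or_ne j d with rfl | hjd
    · simp [exteriorMul_apply, exteriorBraid_apply, hbd, hlt.not_gt]
    · by_cases hjb : j < b
      · simp [exteriorMul_apply, exteriorBraid_apply, hbd, hlt.not_gt, hjd, (hjb.trans hlt).not_gt]
      · simp [exteriorMul_apply, exteriorBraid_apply, hbd, hlt.not_gt, hjb]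
  by_cases hbS : b ∈ S
  swap
  · simp [exteriorMul_apply, exteriorBraid_apply, hbd, hbS]
  rcases eq_or_ne j b with rfl | hjb
  · simp [exteriorMul_apply, exteriorBraid_apply, hbd]
  rcases eq_or_ne j d with rfl | hjd
  · by_cases hdS : j ∈ S
    · have h1 : insert j ((S.erase j).erase b) = S.erase b := by
        rw [Finset.erase_right_comm, Finset.insert_erase (by simp [hdS, hjb])]
      simp only [exteriorBraid_apply, hbd, if_false, exteriorMul_apply, hdS, hbS, hlt, smul_smul,
        inversionWeight_erase hq, h1, hjb, Finset.mem_erase, if_true, ne_eq,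
        not_true, not_false_eq_true, and_self, and_true, and_false, ← sub_smul,
        lt_irrefl]
      rw [eq_comm]
      convert zero_smul k _
      field_simp
      ring
    · have h1 : (insert j (S.erase b)).erase j = S.erase b := by
        rw [Finset.erase_insert (by simp [hdS])]
      simp [exteriorMul_apply, exteriorBraid_apply, hbd, hbd.symm, hdS, hbS, hlt, hlt.not_gt,
        smul_smul, h1, inversionWeight_erase hq, inversionWeight_insert, ← neg_smul]
      congr 1
      field_simp
      try ring
  by_cases hdS : d ∈ S
  · simp [exteriorMul_apply, exteriorBraid_apply, hbd, hdS, hjd, hjd.symm, hbd.symm]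
  by_cases hjS : j ∈ S
  swap
  · simp [exteriorMul_apply, exteriorBraid_apply, hbd, hjd, hjS]
  have h1 : (insert d (S.erase b)).erase j = insert d ((S.erase j).erase b) := by
    rw [Finset.erase_insert_of_ne hjd.symm, Finset.erase_right_comm]
  have h2 : (S.erase b).erase j = (S.erase j).erase b := Finset.erase_right_comm
  simp only [exteriorMul_apply, exteriorBraid_apply, hbd, hjd, hjS, hbS, hdS, hlt, h1, h2,
    hjb, hjb.symm, Finset.mem_erase, Finset.mem_insert,
    inversionWeight_erase hq, smul_smul, if_true, if_false, and_true,
    not_false_eq_true, ne_eq, or_true, and_false]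
  rw [inversionWeight_insert (by simp [hdS]), inversionWeight_erase hq hbS]
  rcases hjb.lt_or_gt with hjb' | hjb' <;> rcases hjd.lt_or_gt with hjd' | hjd'
  · simp [hjb', hjb'.not_gt, hjd', hjd'.not_gt]
    congr 1
    field_simp
  · simp [hjb', hjb'.not_gt, hjd', hjd'.not_gt, hlt.not_gt, smul_smul]
    match_scalars
    field_simp
    ring
  · exact absurd (hjb'.trans hjd') hlt.not_gt
  · simp [hjb', hjb'.not_gt, hjd', hjd'.not_gt]
    congr 1
    field_simp

end

section

variable {k R : Type*} [Field k] [Ring R] [Algebra k R] (q : k) {n : ℕ} (t : Fin n → Fin n → R)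

/-- Left multiplication by `ω_c = ∑ j, t c j • ξ_j` on the quantum exterior algebra over `R`. -/
def rowMul (c : Fin n) : (Finset (Fin n) → R) →ₗ[k] (Finset (Fin n) → R) :=
  ∑ j, Algebra.lsmul k k _ (t c j) ∘ₗ (exteriorMul q R j).restrictScalars k

/-- The component at `x_d` of left multiplication by `∑ b, t a b • x_b` on the quantum exterior
algebra over `R`. -/
def rowBraid (a d : Fin n) : (Finset (Fin n) → R) →ₗ[k] (Finset (Fin n) → R) :=
  ∑ b, Algebra.lsmul k k _ (t a b) ∘ₗ (exteriorBraid q R b d).restrictScalars k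

/-- The product of the `ω_c`, `c ∈ K`, in increasing order. Its coefficients are the quantum
minors of `t` with row set `K`. -/
def rowMinor (K : Finset (Fin n)) : Finset (Fin n) → R :=
  K.sort.foldr (fun c f => rowMul q t c f) (Pi.single ∅ 1)

variable {q t}

theorem rowMul_eq_sum (c : Fin n) (f : Finset (Fin n) → R) :
    rowMul q t c f = ∑ j, t c j • exteriorMul q R j f := by
  simp [rowMul]

theorem rowBraid_eq_sum (a d : Fin n) (f : Finset (Fin n) → R) :
    rowBraid q t a d f = ∑ b, t a b • exteriorBraid q R b d f := by
  simp [rowBraid]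

theorem rowMul_apply (c : Fin n) (f : Finset (Fin n) → R) (S : Finset (Fin n)) :
    rowMul q t c f S = ∑ j ∈ S, inversionWeight q j S • (t c j * f (S.erase j)) := by
  simp [rowMul_eq_sum, exteriorMul_apply, Finset.sum_ite_mem]

theorem rowMul_op_smul (c : Fin n) (r : R) (f : Finset (Fin n) → R) :
    rowMul q t c (MulOpposite.op r • f) = MulOpposite.op r • rowMul q t c f := by
  ext S
  simp [rowMul_apply, Finset.sum_mul, mul_assoc]

theorem rowBraid_apply_of_mem {d : Fin n} {S : Finset (Fin n)} (hd : d ∈ S) (a : Fin n)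
    (f : Finset (Fin n) → R) : rowBraid q t a d f S = q⁻¹ • (t a d * f S) := by
  simp only [rowBraid_eq_sum, Finset.sum_apply, Pi.smul_apply, exteriorBraid_apply, hd]
  rw [Finset.sum_eq_single d (by intro b _ hb; simp [hb]) (by simp)]
  simp

theorem rowBraid_apply_of_notMem {d : Fin n} {S : Finset (Fin n)} (hd : d ∉ S) (a : Fin n)
    (f : Finset (Fin n) → R) :
    rowBraid q t a d f S = t a d * f S + ∑ b ∈ S with d < b,
      (-(q - q⁻¹) * inversionWeight q b S * (inversionWeight q d S)⁻¹) •
        (t a b * f (insert d (S.erase b))) := by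
  simp only [rowBraid_eq_sum, Finset.sum_apply, Pi.smul_apply, exteriorBraid_apply, hd]
  rw [← Finset.add_sum_erase _ _ (Finset.mem_univ d), Finset.sum_filter]
  congr 1
  · simp
  · rw [← Finset.sum_subset (Finset.subset_univ S |> Finset.erase_subset_erase d),
      Finset.erase_eq_of_notMem hd]
    · refine Finset.sum_congr rfl fun b hb => ?_
      have hbd : b ≠ d := fun h => hd (h ▸ hb)
      simp [hb, hbd]
    · intro b hb hbS
      simp_all

theorem rowBraid_single_empty (a d : Fin n) :
    rowBraid q t a d (Pi.single ∅ 1) = MulOpposite.op (t a d) • Pi.single ∅ 1 := by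
  ext S
  by_cases hd : d ∈ S
  · have hS : S ≠ ∅ := Finset.ne_empty_of_mem hd
    simp [rowBraid_apply_of_mem hd, hS]
  · rw [rowBraid_apply_of_notMem hd]
    by_cases hS : S = ∅
    · simp [hS]
    · simp [hS]

theorem IsQuantumMatrix.rowBraid_rowMul (ht : IsQuantumMatrix q t) (hq : q ≠ 0) (a c d : Fin n)
    (f : Finset (Fin n) → R) :
    rowBraid q t a d (rowMul q t c f) =
      (if a = c then q⁻¹ else 1) • rowMul q t c (rowBraid q t a d f) -
        (if c < a then q - q⁻¹ else 0) • rowMul q t a (rowBraid q t c d f) := by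
  have hmul (a c : Fin n) : rowMul q t a (rowBraid q t c d f) =
      ∑ b, ∑ j, (t a j * t c b) • exteriorMul q R j (exteriorBraid q R b d f) := by
    simp only [rowMul_eq_sum, rowBraid_eq_sum, map_sum, map_smul, smul_smul]
  have hbraid : rowBraid q t a d (rowMul q t c f) =
      ∑ b, ∑ j, (t a b * t c j) • exteriorBraid q R b d (exteriorMul q R j f) := by
    simp only [rowMul_eq_sum, rowBraid_eq_sum, map_sum, map_smul, smul_smul]
    exact Finset.sum_comm
  have hswap : ∑ b, ∑ j, (t a b * t c j) • (if j < b then q - q⁻¹ else 0) •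
        exteriorMul q R b (exteriorBraid q R j d f) =
      ∑ b, ∑ j, (t a j * t c b) • (if b < j then q - q⁻¹ else 0) •
        exteriorMul q R j (exteriorBraid q R b d f) := Finset.sum_comm
  rw [hbraid, hmul, hmul]
  simp only [exteriorBraid_exteriorMul hq, smul_sub, Finset.sum_sub_distrib]
  rw [hswap]
  simp only [Finset.smul_sum, ← Finset.sum_sub_distrib]
  refine Finset.sum_congr rfl fun b _ => Finset.sum_congr rfl fun j _ => ?_
  have h := congrArg (· • exteriorMul q R j (exteriorBraid q R b d f)) (ht.rtt hq a c b j)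
  simp only [sub_smul, smul_assoc] at h
  rw [smul_comm (t a b * t c j), smul_comm (t a j * t c b)]
  exact h

theorem sum_smul_exteriorMul_exteriorMul_eq_zero (hq : q ≠ 0) (A : Fin n → Fin n → R)
    (hA : ∀ i j, i < j → A i j = q • A j i) (f : Finset (Fin n) → R) :
    ∑ j, ∑ i, A j i • exteriorMul q R j (exteriorMul q R i f) = 0 := by
  set g : Fin n → Fin n → Finset (Fin n) → R := fun j i =>
    A j i • exteriorMul q R j (exteriorMul q R i f)
  have hsplit (j i : Fin n) : g j i = (if i < j then g j i else 0) + if j < i then g j i else 0 := by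
    rcases lt_trichotomy i j with h | rfl | h
    · simp [h, h.not_gt]
    · simp [g, exteriorMul_mul_self]
    · simp [h, h.not_gt]
  change ∑ j, ∑ i, g j i = 0
  rw [Finset.sum_congr rfl fun j _ => Finset.sum_congr rfl fun i _ => hsplit j i]
  simp only [Finset.sum_add_distrib]
  rw [Finset.sum_comm (f := fun j i => if j < i then g j i else 0), ← Finset.sum_add_distrib]
  simp only [← Finset.sum_add_distrib]
  refine Finset.sum_eq_zero fun j _ => Finset.sum_eq_zero fun i _ => ?_
  split_ifs with h
  · simp only [g]
    rw [exteriorMul_mul_comm hq h, hA i j h, smul_comm, smul_assoc]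
    simp
  · simp

theorem rowMul_rowMul_eq_sum (a c : Fin n) (f : Finset (Fin n) → R) :
    rowMul q t c (rowMul q t a f) =
      ∑ j, ∑ i, (t c j * t a i) • exteriorMul q R j (exteriorMul q R i f) := by
  simp only [rowMul_eq_sum, map_sum, map_smul, smul_smul]
  exact Finset.sum_comm

theorem IsQuantumMatrix.rowMul_rowMul_self (ht : IsQuantumMatrix q t) (hq : q ≠ 0) (a : Fin n)
    (f : Finset (Fin n) → R) : rowMul q t a (rowMul q t a f) = 0 := by
  rw [rowMul_rowMul_eq_sum]
  exact sum_smul_exteriorMul_exteriorMul_eq_zero hq (fun j i => t a j * t a i)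
    (fun i j h => ht.row a h) f

theorem IsQuantumMatrix.rowMul_rowMul (ht : IsQuantumMatrix q t) (hq : q ≠ 0) {a c : Fin n}
    (h : a < c) (f : Finset (Fin n) → R) :
    rowMul q t c (rowMul q t a f) = -q • rowMul q t a (rowMul q t c f) := by
  rw [← sub_eq_zero]
  have key := sum_smul_exteriorMul_exteriorMul_eq_zero hq
    (fun j i => t c j * t a i + q • (t a j * t c i)) (fun i j hij => by
      simp only [ht.cross1 h hij, ht.cross2 h hij]
      match_scalars <;> field_simp
      ring) f
  rw [← key]
  simp only [rowMul_rowMul_eq_sum, Finset.smul_sum, add_smul, Finset.sum_add_distrib, smul_assoc,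
    neg_smul, sub_neg_eq_add, Finset.sum_neg_distrib]

theorem rowMinor_empty : rowMinor q t ∅ = Pi.single ∅ 1 := by
  simp [rowMinor]

theorem rowMinor_insert {x : Fin n} {K : Finset (Fin n)} (h : ∀ y ∈ K, x < y) :
    rowMinor q t (insert x K) = rowMul q t x (rowMinor q t K) := by
  rw [rowMinor, Finset.sort_insert (r := (· ≤ ·)) (fun b hb => (h b hb).le)
    fun hx => lt_irrefl _ (h x hx)]
  rfl

theorem IsQuantumMatrix.rowMul_rowMinor_of_mem (ht : IsQuantumMatrix q t) (hq : q ≠ 0)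
    {a : Fin n} {K : Finset (Fin n)} (ha : a ∈ K) : rowMul q t a (rowMinor q t K) = 0 := by
  induction K using Finset.induction_on_min with
  | empty => simp at ha
  | insert x K h ih =>
    rw [rowMinor_insert h]
    rcases Finset.mem_insert.1 ha with rfl | ha
    · exact ht.rowMul_rowMul_self hq _ _
    · rw [ht.rowMul_rowMul hq (h a ha), ih ha]
      simp

theorem IsQuantumMatrix.rowMul_rowMinor_of_notMem (ht : IsQuantumMatrix q t) (hq : q ≠ 0)
    {a : Fin n} {K : Finset (Fin n)} (ha : a ∉ K) :
    rowMul q t a (rowMinor q t K) = inversionWeight q a K • rowMinor q t (insert a K) := by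
  induction K using Finset.induction_on_min with
  | empty => rw [rowMinor_insert (by simp), inversionWeight_eq_one (by simp), one_smul]
  | insert x K h ih =>
    have hx : x ∉ K := fun hx => lt_irrefl _ (h x hx)
    obtain ⟨hax, ha⟩ : a ≠ x ∧ a ∉ K := by simpa using ha
    rcases hax.lt_or_gt with hlt | hlt
    · rw [rowMinor_insert (K := insert x K), inversionWeight_eq_one, one_smul]
      · simpa [hlt.le] using fun s hs => (hlt.trans (h s hs)).le
      · simpa [hlt] using fun s hs => hlt.trans (h s hs)
    · rw [rowMinor_insert h, ht.rowMul_rowMul hq hlt, ih ha, map_smul, ← rowMinor_insert,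
        Finset.insert_comm, inversionWeight_insert hx, smul_smul, mul_comm, if_pos hlt]
      simpa [hlt] using h

theorem IsQuantumMatrix.rowMul_rowMinor_erase (ht : IsQuantumMatrix q t) (hq : q ≠ 0)
    {c : Fin n} {K : Finset (Fin n)} (hc : c ∈ K) :
    rowMul q t c (rowMinor q t (K.erase c)) = inversionWeight q c K • rowMinor q t K := by
  rw [ht.rowMul_rowMinor_of_notMem hq (Finset.notMem_erase c K), Finset.insert_erase hc,
    inversionWeight_erase hq hc, if_neg (lt_irrefl c), mul_one]

theorem IsQuantumMatrix.rowBraid_rowMinor_of_notMem (ht : IsQuantumMatrix q t) (hq : q ≠ 0)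
    {a : Fin n} {K : Finset (Fin n)} (ha : a ∉ K) (d : Fin n) :
    rowBraid q t a d (rowMinor q t K) = MulOpposite.op (t a d) • rowMinor q t K -
      (q - q⁻¹) • ∑ c ∈ K with c < a, (inversionWeight q c K)⁻¹ •
        MulOpposite.op (t c d) • rowMul q t a (rowMinor q t (K.erase c)) := by
  induction K using Finset.induction_on_min generalizing a with
  | empty => simp [rowMinor_empty, rowBraid_single_empty]
  | insert x K h ih =>
    have hx : x ∉ K := fun hx => lt_irrefl _ (h x hx)
    obtain ⟨hax, ha⟩ : a ≠ x ∧ a ∉ K := by simpa using ha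
    have hbraid : rowBraid q t x d (rowMinor q t K) = MulOpposite.op (t x d) • rowMinor q t K := by
      rw [ih hx, Finset.filter_eq_empty_iff.2 fun c hc => (h c hc).not_gt]
      simp
    rw [rowMinor_insert h, ht.rowBraid_rowMul hq, if_neg hax, one_smul, ih ha, hbraid,
      Finset.filter_insert, map_sub, rowMul_op_smul, rowMul_op_smul]
    rcases hax.lt_or_gt with hlt | hlt
    · rw [Finset.filter_eq_empty_iff.2 fun c hc => (hlt.trans (h c hc)).not_gt]
      simp [hlt.not_gt]
    · rw [if_pos hlt, if_pos hlt, Finset.sum_insert (by simp [hx]), Finset.erase_insert hx,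
        inversionWeight_eq_one (by simpa using fun s hs => (h s hs).le), inv_one, one_smul,
        smul_add, sub_sub, add_comm (_ • _)]
      congr 2
      rw [map_smul, map_sum]
      congr 1
      refine Finset.sum_congr rfl fun c hc => ?_
      have hcK : c ∈ K := (Finset.mem_filter.1 hc).1
      rw [map_smul, rowMul_op_smul, Finset.erase_insert_of_ne (h c hcK).ne,
        rowMinor_insert fun y hy => h y (Finset.mem_of_mem_erase hy), ht.rowMul_rowMul hq hlt,
        inversionWeight_insert hx, if_pos (h c hcK), smul_comm _ (-q), smul_smul]
      congr 1
      field_simp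

theorem IsQuantumMatrix.rowBraid_rowMinor_of_mem (ht : IsQuantumMatrix q t) (hq : q ≠ 0)
    {a : Fin n} {K : Finset (Fin n)} (ha : a ∈ K) (d : Fin n) :
    rowBraid q t a d (rowMinor q t K) = q⁻¹ • MulOpposite.op (t a d) • rowMinor q t K := by
  induction K using Finset.induction_on_min with
  | empty => simp at ha
  | insert x K h ih =>
    have hx : x ∉ K := fun hx => lt_irrefl _ (h x hx)
    have hbraid : rowBraid q t x d (rowMinor q t K) = MulOpposite.op (t x d) • rowMinor q t K := by
      rw [ht.rowBraid_rowMinor_of_notMem hq hx,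
        Finset.filter_eq_empty_iff.2 fun c hc => (h c hc).not_gt]
      simp
    rw [rowMinor_insert h, ht.rowBraid_rowMul hq, hbraid]
    rcases Finset.mem_insert.1 ha with rfl | ha
    · simp [hbraid, rowMul_op_smul]
    · rw [if_neg (h a ha).ne', ih ha, rowMul_op_smul, ht.rowMul_rowMinor_of_mem hq ha]
      simp [rowMul_op_smul]

end

section

variable {k R : Type*} [Field k] [Ring R] [Algebra k R] {q : k} {n : ℕ} {t : Fin n → Fin n → R}

theorem rowMinor_apply_empty {K : Finset (Fin n)} (hK : K.Nonempty) : rowMinor q t K ∅ = 0 := by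
  induction K using Finset.induction_on_min with
  | empty => simp at hK
  | insert x K h ih => simp [rowMinor_insert h, rowMul_apply]

theorem commute_rowMinor {r : R} {K L : Finset (Fin n)}
    (h : ∀ a ∈ K, ∀ b ∈ L, Commute r (t a b)) : Commute r (rowMinor q t K L) := by
  induction K using Finset.induction_on_min generalizing L with
  | empty =>
    rw [rowMinor_empty]
    by_cases hL : L = ∅
    · simp [hL]
    · simp [hL]
  | insert x K hx ih =>
    rw [rowMinor_insert hx, rowMul_apply]
    refine Commute.sum_right _ _ _ fun j hj => Commute.smul_right (Commute.mul_right ?_ ?_) _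
    · exact h x (Finset.mem_insert_self x K) j hj
    · exact ih fun a ha b hb => h a (Finset.mem_insert_of_mem ha) b (Finset.mem_of_mem_erase hb)

namespace IsQuantumMatrix

/-- Laplace expansion of a quantum minor along its first column. -/
theorem rowMinor_insert_apply_insert (ht : IsQuantumMatrix q t) (K : Finset (Fin n))
    {l : Fin n} {L : Finset (Fin n)} (hl : ∀ j ∈ L, l < j) :
    rowMinor q t K (insert l L) =
      ∑ a ∈ K, inversionWeight q a K • (t a l * rowMinor q t (K.erase a) L) := by
  have hlL : l ∉ L := fun h => lt_irrefl _ (hl l h)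
  induction K using Finset.induction_on_min generalizing L with
  | empty => simp [rowMinor_empty]
  | insert x K h ih =>
    have hx : x ∉ K := fun hx => lt_irrefl _ (h x hx)
    rw [rowMinor_insert h, rowMul_apply, Finset.sum_insert hlL, Finset.sum_insert hx,
      inversionWeight_eq_one (by simpa using fun s hs => (hl s hs).le),
      inversionWeight_eq_one (by simpa using fun s hs => (h s hs).le),
      Finset.erase_insert hlL, Finset.erase_insert hx]
    congr 1
    have hleft : ∀ j ∈ L, inversionWeight q j (insert l L) •
        (t x j * rowMinor q t K ((insert l L).erase j)) =
        ∑ a ∈ K, (inversionWeight q j L * inversionWeight q a K * -q) •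
          (t a l * (t x j * rowMinor q t (K.erase a) (L.erase j))) := fun j hj => by
      rw [Finset.erase_insert_of_ne (hl j hj).ne,
        ih (fun i hi => hl i (Finset.mem_of_mem_erase hi)) (by simp [hlL]),
        inversionWeight_insert hlL, if_pos (hl j hj), Finset.mul_sum, Finset.smul_sum]
      refine Finset.sum_congr rfl fun a ha => ?_
      rw [mul_smul_comm, smul_smul, ← mul_assoc, ht.cross2 (h a ha) (hl j hj), mul_assoc,
        mul_assoc]
      congr 1
      ring
    have hright : ∀ a ∈ K, inversionWeight q a (insert x K) •
        (t a l * rowMinor q t ((insert x K).erase a) L) =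
        ∑ j ∈ L, (inversionWeight q j L * inversionWeight q a K * -q) •
          (t a l * (t x j * rowMinor q t (K.erase a) (L.erase j))) := fun a ha => by
      rw [Finset.erase_insert_of_ne (h a ha).ne,
        rowMinor_insert fun y hy => h y (Finset.mem_of_mem_erase hy), rowMul_apply,
        inversionWeight_insert hx, if_pos (h a ha), Finset.mul_sum, Finset.smul_sum]
      refine Finset.sum_congr rfl fun j hj => ?_
      rw [mul_smul_comm, smul_smul]
      congr 1
      ring
    rw [Finset.sum_congr rfl hleft, Finset.sum_congr rfl hright, Finset.sum_comm]

theorem rowMinor_transpose (ht : IsQuantumMatrix q t) (K L : Finset (Fin n)) :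
    rowMinor q (fun i j => t j i) L K = rowMinor q t K L := by
  induction L using Finset.induction_on_min generalizing K with
  | empty =>
    rcases K.eq_empty_or_nonempty with rfl | hK
    · simp [rowMinor_empty]
    · rw [rowMinor_apply_empty hK, rowMinor_empty, Pi.single_eq_of_ne hK.ne_empty]
  | insert l L hl ih =>
    rw [rowMinor_insert hl, rowMul_apply, ht.rowMinor_insert_apply_insert K hl]
    simp only [ih]

theorem rowMinor_commute (ht : IsQuantumMatrix q t) (hq : q ≠ 0) {K L : Finset (Fin n)}
    {a d : Fin n} (ha : a ∈ K) (hd : d ∈ L) : Commute (rowMinor q t K L) (t a d) := by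
  have h := congrFun (ht.rowBraid_rowMinor_of_mem hq ha d) L
  rw [rowBraid_apply_of_mem hd] at h
  exact (smul_right_injective R (inv_ne_zero hq) h).symm

theorem smul_mul_rowMinor (ht : IsQuantumMatrix q t) (hq : q ≠ 0) {K L : Finset (Fin n)}
    {a d : Fin n} (ha : a ∉ K) (hd : d ∈ L) :
    q⁻¹ • (t a d * rowMinor q t K L) = rowMinor q t K L * t a d -
      (q - q⁻¹) • ∑ c ∈ K with c < a, (inversionWeight q c K)⁻¹ •
        (rowMul q t a (rowMinor q t (K.erase c)) L * t c d) := by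
  have h := congrFun (ht.rowBraid_rowMinor_of_notMem hq ha d) L
  rw [rowBraid_apply_of_mem hd] at h
  simpa using h

theorem exists_rowMinor_mul_rowMul (ht : IsQuantumMatrix q t) (hq : q ≠ 0) {K : Finset (Fin n)}
    (L : Finset (Fin n)) {a c : Fin n} (ha : a ∉ K) (hc : c ∈ K) :
    ∃ u : k, u ≠ 0 ∧ rowMinor q t K L * rowMul q t a (rowMinor q t (K.erase c)) L =
      u • (rowMul q t a (rowMinor q t (K.erase c)) L * rowMinor q t K L) := by
  set D := rowMinor q t K L with hD
  set Y : Fin n → R := fun f => rowMul q t a (rowMinor q t (K.erase f)) L with hY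
  set v : Fin n → R := fun j => rowMinor q t (K.erase c) (L.erase j) with hv
  have hexpand (f : Fin n) : rowMul q t f (rowMinor q t (K.erase c)) L =
      ∑ j ∈ L, inversionWeight q j L • (t f j * v j) := rowMul_apply _ _ _
  have hcomm (j : Fin n) : Commute D (v j) := commute_rowMinor fun x hx y hy =>
    ht.rowMinor_commute hq (Finset.mem_of_mem_erase hx) (Finset.mem_of_mem_erase hy)
  have hpass : ∀ j ∈ L, D * t a j = q⁻¹ • (t a j * D) + (q - q⁻¹) •
      ∑ f ∈ K with f < a, (inversionWeight q f K)⁻¹ • (Y f * t f j) := fun j hj => by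
    rw [ht.smul_mul_rowMinor hq ha hj]
    abel
  have hrest : ∑ f ∈ K with f < a, (inversionWeight q f K)⁻¹ •
      (Y f * rowMul q t f (rowMinor q t (K.erase c)) L) = if c < a then Y c * D else 0 := by
    rw [Finset.sum_filter, Finset.sum_eq_single c]
    · rw [ht.rowMul_rowMinor_erase hq hc, Pi.smul_apply, mul_smul_comm, smul_smul,
        inv_mul_cancel₀ (inversionWeight_ne_zero hq c K), one_smul]
    · intro f hf hfc
      rw [ht.rowMul_rowMinor_of_mem hq (Finset.mem_erase.2 ⟨hfc, hf⟩)]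
      simp
    · exact fun h => absurd hc h
  have hmain : D * Y c = q⁻¹ • (Y c * D) + (q - q⁻¹) • if c < a then Y c * D else 0 := by
    rw [← hrest]
    simp only [hexpand, Finset.mul_sum, Finset.smul_sum]
    rw [Finset.sum_comm]
    simp only [Y, hexpand a, Finset.mul_sum, Finset.sum_mul, Finset.smul_sum]
    rw [← Finset.sum_add_distrib]
    refine Finset.sum_congr rfl fun j hj => ?_
    rw [mul_smul_comm, ← mul_assoc, hpass j hj, add_mul, smul_mul_assoc, mul_assoc (t a j),
      (hcomm j).eq, smul_add]
    simp only [Y, Finset.sum_mul, Finset.smul_sum, smul_mul_assoc, mul_smul_comm, mul_assoc,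
      smul_comm (inversionWeight q j L)]
  refine ⟨if c < a then q else q⁻¹, by split_ifs <;> simp [hq], ?_⟩
  rw [hmain]
  split_ifs
  · rw [← add_smul, add_sub_cancel]
  · simp [Y]

/-- Quantum minors with the same columns whose row sets differ by one element commute up to a
nonzero scalar. -/
theorem exists_rowMinor_mul_rowMinor_row (ht : IsQuantumMatrix q t) (hq : q ≠ 0)
    {K : Finset (Fin n)} (L : Finset (Fin n)) {a c : Fin n} (ha : a ∉ K) (hc : c ∈ K) :
    ∃ u : k, u ≠ 0 ∧ rowMinor q t K L * rowMinor q t (insert a (K.erase c)) L =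
      u • (rowMinor q t (insert a (K.erase c)) L * rowMinor q t K L) := by
  obtain ⟨u, hu, h⟩ := ht.exists_rowMinor_mul_rowMul hq L ha hc
  refine ⟨u, hu, ?_⟩
  have hw := inversionWeight_ne_zero hq a (K.erase c)
  rw [ht.rowMul_rowMinor_of_notMem hq (by simp [ha]), Pi.smul_apply, mul_smul_comm,
    smul_mul_assoc, smul_comm u] at h
  exact smul_right_injective R hw h

/-- Quantum minors with the same rows whose column sets differ by one element commute up to a
nonzero scalar. -/
theorem exists_rowMinor_mul_rowMinor_col (ht : IsQuantumMatrix q t) (hq : q ≠ 0)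
    (K : Finset (Fin n)) {L : Finset (Fin n)} {b d : Fin n} (hd : d ∉ L) (hb : b ∈ L) :
    ∃ u : k, u ≠ 0 ∧ rowMinor q t K L * rowMinor q t K (insert d (L.erase b)) =
      u • (rowMinor q t K (insert d (L.erase b)) * rowMinor q t K L) := by
  simpa only [ht.rowMinor_transpose] using
    ht.transpose.exists_rowMinor_mul_rowMinor_row hq K hd hb

end IsQuantumMatrix

end

section

variable {k R : Type*} [Field k] [Ring R] [Algebra k R]

/-- The elements satisfying both Ore conditions with respect to the powers of `s`. -/
def oreSubalgebra (k : Type*) {R : Type*} [Field k] [Ring R] [Algebra k R] (s : R) :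
    Subalgebra k R where
  carrier := {r | (∀ i, ∃ j x, s ^ j * r = x * s ^ i) ∧ ∀ i, ∃ j x, r * s ^ j = s ^ i * x}
  mul_mem' := by
    rintro r₁ r₂ ⟨hl₁, hr₁⟩ ⟨hl₂, hr₂⟩
    refine ⟨fun i => ?_, fun i => ?_⟩
    · obtain ⟨j₂, x₂, h₂⟩ := hl₂ i
      obtain ⟨j₁, x₁, h₁⟩ := hl₁ j₂
      exact ⟨j₁, x₁ * x₂, by rw [← mul_assoc, h₁, mul_assoc, h₂, mul_assoc]⟩
    · obtain ⟨j₁, x₁, h₁⟩ := hr₁ i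
      obtain ⟨j₂, x₂, h₂⟩ := hr₂ j₁
      exact ⟨j₂, x₁ * x₂, by rw [mul_assoc, h₂, ← mul_assoc, h₁, mul_assoc]⟩
  add_mem' := by
    rintro r₁ r₂ ⟨hl₁, hr₁⟩ ⟨hl₂, hr₂⟩
    refine ⟨fun i => ?_, fun i => ?_⟩
    · obtain ⟨j₁, x₁, h₁⟩ := hl₁ i
      obtain ⟨j₂, x₂, h₂⟩ := hl₂ i
      refine ⟨j₂ + j₁, s ^ j₂ * x₁ + s ^ j₁ * x₂, ?_⟩
      rw [mul_add, add_mul, mul_assoc _ x₁, ← h₁, mul_assoc _ x₂, ← h₂, ← mul_assoc, ← mul_assoc,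
        ← pow_add, ← pow_add, add_comm j₁]
    · obtain ⟨j₁, x₁, h₁⟩ := hr₁ i
      obtain ⟨j₂, x₂, h₂⟩ := hr₂ i
      refine ⟨j₁ + j₂, x₁ * s ^ j₂ + x₂ * s ^ j₁, ?_⟩
      rw [mul_add, add_mul, ← mul_assoc _ x₁, ← h₁, ← mul_assoc _ x₂, ← h₂, mul_assoc, mul_assoc,
        ← pow_add, ← pow_add, add_comm j₂]
  algebraMap_mem' c :=
    ⟨fun i => ⟨i, algebraMap k R c, (Algebra.commutes c _).symm⟩,
      fun i => ⟨i, algebraMap k R c, Algebra.commutes c _⟩⟩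

theorem mem_oreSubalgebra_of_sub_mem {s r : R} {u : k} (hu : u ≠ 0)
    (h : s * r - u • (r * s) ∈ oreSubalgebra k s) : r ∈ oreSubalgebra k s := by
  obtain ⟨hl, hr⟩ := h
  refine ⟨fun i => ?_, fun i => ?_⟩
  · induction i with
    | zero => exact ⟨0, r, by simp⟩
    | succ i ih =>
      obtain ⟨j, x, hx⟩ := ih
      obtain ⟨j', y, hy⟩ := hl (i + 1)
      refine ⟨j + j' + 1, u • (s ^ j' * x) + s ^ j * y, ?_⟩
      have e : s ^ (j + j' + 1) * r =
          u • (s ^ j' * (s ^ j * r) * s) + s ^ j * (s ^ j' * (s * r - u • (r * s))) := by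
        simp only [mul_sub, mul_smul_comm, ← mul_assoc, ← pow_add, ← pow_succ, add_comm j' j]
        abel
      rw [e, hx, hy, add_mul, smul_mul_assoc, pow_succ]
      simp only [mul_assoc]
  · induction i with
    | zero => exact ⟨0, r, by simp⟩
    | succ i ih =>
      obtain ⟨j, x, hx⟩ := ih
      obtain ⟨j', y, hy⟩ := hr (i + 1)
      refine ⟨j + j' + 1, u⁻¹ • (x * s ^ j' - y * s ^ j), ?_⟩
      have e : r * s ^ (j + j' + 1) =
          u⁻¹ • (s * (r * s ^ j) * s ^ j' - (s * r - u • (r * s)) * s ^ j' * s ^ j) := by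
        rw [sub_mul, sub_mul, smul_mul_assoc, smul_mul_assoc]
        simp only [mul_assoc, ← pow_add, ← pow_succ', add_comm j' j]
        rw [sub_sub_cancel, smul_smul, inv_mul_cancel₀ hu, one_smul,
          show j + j' + 1 = j' + 1 + j by omega]
      rw [e, hx, hy, mul_smul_comm, mul_sub, pow_succ']
      simp only [mul_assoc]

theorem mem_oreSubalgebra_of_mul_eq {s r : R} {u : k} (hu : u ≠ 0) (h : s * r = u • (r * s)) :
    r ∈ oreSubalgebra k s :=
  mem_oreSubalgebra_of_sub_mem hu (by rw [h, sub_self]; exact zero_mem _)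

variable {q : k} {n : ℕ} {t : Fin n → Fin n → R}

theorem IsQuantumMatrix.mem_oreSubalgebra_rowMinor (ht : IsQuantumMatrix q t) (hq : q ≠ 0)
    (K L : Finset (Fin n)) (a d : Fin n) : t a d ∈ oreSubalgebra k (rowMinor q t K L) := by
  have hrow {a c : Fin n} (ha : a ∉ K) (hc : c ∈ K) :
      rowMul q t a (rowMinor q t (K.erase c)) L ∈ oreSubalgebra k (rowMinor q t K L) := by
    obtain ⟨u, hu, h⟩ := ht.exists_rowMinor_mul_rowMul hq L ha hc
    exact mem_oreSubalgebra_of_mul_eq hu h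
  have hcol {d b : Fin n} (hd : d ∉ L) (hb : b ∈ L) :
      rowMinor q t K (insert d (L.erase b)) ∈ oreSubalgebra k (rowMinor q t K L) := by
    obtain ⟨u, hu, h⟩ := ht.exists_rowMinor_mul_rowMinor_col hq K hd hb
    exact mem_oreSubalgebra_of_mul_eq hu h
  have hin {a d : Fin n} (ha : a ∈ K) (hd : d ∈ L) :
      t a d ∈ oreSubalgebra k (rowMinor q t K L) :=
    mem_oreSubalgebra_of_mul_eq one_ne_zero (by rw [one_smul, (ht.rowMinor_commute hq ha hd).eq])
  have hrow_mem {a d : Fin n} (ha : a ∉ K) (hd : d ∈ L) :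
      t a d ∈ oreSubalgebra k (rowMinor q t K L) := by
    refine mem_oreSubalgebra_of_sub_mem (inv_ne_zero hq) ?_
    rw [ht.smul_mul_rowMinor hq ha hd, sub_sub_cancel]
    exact Subalgebra.smul_mem _ (sum_mem fun c hc => Subalgebra.smul_mem _
      (mul_mem (hrow ha (Finset.mem_filter.1 hc).1) (hin (Finset.mem_filter.1 hc).1 hd)) _) _
  have hcol_mem {a d : Fin n} (ha : a ∈ K) (hd : d ∉ L) :
      t a d ∈ oreSubalgebra k (rowMinor q t K L) := by
    refine mem_oreSubalgebra_of_sub_mem hq ?_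
    have h := congrFun (ht.rowBraid_rowMinor_of_mem hq ha d) L
    rw [rowBraid_apply_of_notMem hd, Pi.smul_apply, Pi.smul_apply, op_smul_eq_mul,
      eq_inv_smul_iff₀ hq] at h
    rw [← h, smul_add, add_sub_cancel_left]
    exact Subalgebra.smul_mem _ (sum_mem fun b hb => Subalgebra.smul_mem _
      (mul_mem (hin ha (Finset.mem_filter.1 hb).1) (hcol hd (Finset.mem_filter.1 hb).1)) _) _
  by_cases ha : a ∈ K <;> by_cases hd : d ∈ L
  · exact hin ha hd
  · exact hcol_mem ha hd
  · exact hrow_mem ha hd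
  · refine mem_oreSubalgebra_of_sub_mem one_ne_zero ?_
    have h := congrFun (ht.rowBraid_rowMinor_of_notMem hq ha d) L
    rw [rowBraid_apply_of_notMem hd, Pi.sub_apply, Pi.smul_apply, op_smul_eq_mul,
      eq_sub_iff_add_eq] at h
    rw [one_smul, ← h, add_assoc, add_sub_cancel_left]
    refine add_mem (sum_mem fun b hb => Subalgebra.smul_mem _ (mul_mem
      (hrow_mem ha (Finset.mem_filter.1 hb).1) (hcol hd (Finset.mem_filter.1 hb).1)) _) ?_
    rw [Pi.smul_apply, Finset.sum_apply]
    exact Subalgebra.smul_mem _ (sum_mem fun c hc => Subalgebra.smul_mem _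
      (mul_mem (hrow ha (Finset.mem_filter.1 hc).1) (hcol_mem (Finset.mem_filter.1 hc).1 hd)) _) _

end

section

open Equiv

theorem invCount_eq_add {m : ℕ} (p : Fin (m + 1)) (σ : Perm (Fin m)) (τ : Perm (Fin (m + 1)))
    (h0 : τ 0 = p) (hs : ∀ i : Fin m, τ i.succ = p.succAbove (σ i)) :
    invCount τ = p + invCount σ := by
  have hcard : (Finset.univ.filter fun j : Fin m => p.succAbove (σ j) < p).card = p := by
    have e : (Finset.univ.filter fun j : Fin m => p.succAbove (σ j) < p) =
        (Finset.univ.filter fun j : Fin m => j.castSucc < p).map σ.symm.toEmbedding := by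
      ext j
      simp [Fin.succAbove_lt_iff_castSucc_lt]
    rw [e, Finset.card_map]
    simp only [Fin.lt_def, Fin.val_castSucc, Fin.card_filter_val_lt]
    omega
  simp only [invCount, Finset.card_filter, Fintype.sum_prod_type] at hcard ⊢
  rw [Fin.sum_univ_succ]
  simp only [Fin.sum_univ_succ, h0, hs, hcard, lt_irrefl, Fin.succ_pos, Fin.not_lt_zero,
    false_and, if_false, true_and, zero_add, Fin.succ_lt_succ_iff, Fin.succAbove_lt_succAbove_iff]

/-- A permutation of `Fin (m + 1)` amounts to the image of `0` and a permutation of `Fin m`. -/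
def permSuccEquiv (m : ℕ) : Fin (m + 1) × Perm (Fin m) ≃ Perm (Fin (m + 1)) where
  toFun x := (finSuccEquiv' 0).trans ((optionCongr x.2).trans (finSuccEquiv' x.1).symm)
  invFun τ := (τ 0, removeNone ((finSuccEquiv' 0).symm.trans (τ.trans (finSuccEquiv' (τ 0)))))
  left_inv x := by
    refine Prod.ext (by simp) ?_
    convert removeNone_optionCongr x.2 using 2
    ext
    simp
  right_inv τ := by
    ext i
    simp

theorem permSuccEquiv_apply_zero {m : ℕ} (x : Fin (m + 1) × Perm (Fin m)) :
    permSuccEquiv m x 0 = x.1 := by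
  simp [permSuccEquiv]

theorem permSuccEquiv_apply_succ {m : ℕ} (x : Fin (m + 1) × Perm (Fin m)) (i : Fin m) :
    permSuccEquiv m x i.succ = x.1.succAbove (x.2 i) := by
  simp [permSuccEquiv, finSuccEquiv'_above (Fin.zero_le i.castSucc)]

theorem rowMinor_image {k R : Type*} [Field k] [Ring R] [Algebra k R] (q : k) {n m : ℕ}
    (t : Fin n → Fin n → R) {r c : Fin m → Fin n} (hr : StrictMono r) (hc : StrictMono c) :
    rowMinor q t (Finset.univ.image r) (Finset.univ.image c) =
      ∑ σ : Perm (Fin m),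
        (-q) ^ invCount σ • (List.ofFn fun i => t (r i) (c (σ i))).prod := by
  induction m with
  | zero => simp [rowMinor_empty, invCount]
  | succ m ih =>
    have hrow : Finset.univ.image r = insert (r 0) (Finset.univ.image (r ∘ Fin.succ)) := by
      ext x
      simp [Fin.exists_fin_succ, eq_comm]
    have hcol (p : Fin (m + 1)) : (Finset.univ.image c).erase (c p) =
        Finset.univ.image (c ∘ p.succAbove) := by
      ext x
      simp only [Finset.mem_erase, Finset.mem_image, Finset.mem_univ, true_and]
      constructor
      · rintro ⟨hx, i, rfl⟩
        obtain ⟨j, rfl⟩ := Fin.exists_succAbove_eq fun h : i = p => hx (h ▸ rfl)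
        exact ⟨j, rfl⟩
      · rintro ⟨i, rfl⟩
        exact ⟨fun h => Fin.succAbove_ne p i (hc.injective h), _, rfl⟩
    have hw (p : Fin (m + 1)) : inversionWeight q (c p) (Finset.univ.image c) = (-q) ^ (p : ℕ) := by
      rw [inversionWeight, Finset.filter_image, Finset.card_image_of_injective _ hc.injective]
      simp only [hc.lt_iff_lt, Fin.lt_def, Fin.card_filter_val_lt]
      congr 1
      omega
    rw [hrow, rowMinor_insert, rowMul_apply, Finset.sum_image hc.injective.injOn,
      ← (permSuccEquiv m).sum_comp, Fintype.sum_prod_type]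
    · refine Finset.sum_congr rfl fun p _ => ?_
      rw [hw, hcol, ih (hr.comp Fin.strictMono_succ) (hc.comp (Fin.strictMono_succAbove p)),
        Finset.mul_sum, Finset.smul_sum]
      refine Finset.sum_congr rfl fun σ _ => ?_
      rw [invCount_eq_add p σ _ (permSuccEquiv_apply_zero _) (permSuccEquiv_apply_succ _),
        List.ofFn_succ, List.prod_cons, mul_smul_comm, smul_smul, pow_add,
        permSuccEquiv_apply_zero]
      simp only [permSuccEquiv_apply_succ]
      rfl
    · simp only [Finset.mem_image, Finset.mem_univ, true_and]
      rintro _ ⟨i, rfl⟩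
      exact hr i.succ_pos

end

section

variable {k : Type*} [Field k] {q : k} {n : ℕ}

theorem isQuantumMatrix_tgen : IsQuantumMatrix q (tgen q n) where
  row a _ _ h := by
    simpa [tgen] using RingQuot.mkAlgHom_rel k (QMatRel.row (q := q) a h)
  col c h := by
    simpa [tgen] using RingQuot.mkAlgHom_rel k (QMatRel.col (q := q) c h)
  cross1 hab hcd := by
    simpa [tgen] using RingQuot.mkAlgHom_rel k (QMatRel.cross1 (q := q) hab hcd)
  cross2 hab hdc := by
    simpa [tgen] using RingQuot.mkAlgHom_rel k (QMatRel.cross2 (q := q) hab hdc)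

theorem qMinor_eq_rowMinor (m : ℕ) (K L : Finset (Fin n)) (hK : K.card = m) (hL : L.card = m) :
    qMinor q m K L hK hL = rowMinor q (tgen q n) K L := by
  have h := rowMinor_image q (tgen q n) (K.orderEmbOfFin hK).strictMono
    (L.orderEmbOfFin hL).strictMono
  rw [Finset.image_orderEmbOfFin_univ, Finset.image_orderEmbOfFin_univ] at h
  exact h.symm

theorem subalgebra_eq_top_of_tgen_mem {S : Subalgebra k (QMat k q n)}
    (h : ∀ i j, tgen q n i j ∈ S) : S = ⊤ := by
  refine eq_top_iff.2 fun r _ => ?_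
  obtain ⟨x, rfl⟩ := RingQuot.mkAlgHom_surjective k (QMatRel k q n) r
  induction x using FreeAlgebra.induction with
  | grade0 c => simp
  | grade1 x => exact h x.1 x.2
  | mul x y hx hy => simpa using mul_mem (hx trivial) (hy trivial)
  | add x y hx hy => simpa using add_mem (hx trivial) (hy trivial)

end

/-- The multiplicative set generated by a quantum minor `D^K_L` and `1` is a
two-sided Ore set in `M_q(n)`: it satisfies both the left and the right Ore
conditions. -/
theorem qMinor_Ore {k : Type*} [Field k] (q : k) (hq : q ≠ 0)
    {n : ℕ} (m : ℕ) (K L : Finset (Fin n)) (hK : K.card = m) (hL : L.card = m) :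
    (∀ s ∈ Submonoid.closure {qMinor q m K L hK hL}, ∀ r : QMat k q n,
      ∃ s' ∈ Submonoid.closure {qMinor q m K L hK hL}, ∃ r' : QMat k q n,
        s' * r = r' * s) ∧
    (∀ s ∈ Submonoid.closure {qMinor q m K L hK hL}, ∀ r : QMat k q n,
      ∃ s'' ∈ Submonoid.closure {qMinor q m K L hK hL}, ∃ r'' : QMat k q n,
        r * s'' = s * r'') := by
  rw [qMinor_eq_rowMinor]
  have hmem (r : QMat k q n) : r ∈ oreSubalgebra k (rowMinor q (tgen q n) K L) := by
    rw [subalgebra_eq_top_of_tgen_mem (isQuantumMatrix_tgen.mem_oreSubalgebra_rowMinor hq K L)]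
    exact Algebra.mem_top
  simp only [Submonoid.mem_closure_singleton]
  constructor
  · rintro _ ⟨i, rfl⟩ r
    obtain ⟨j, x, h⟩ := (hmem r).1 i
    exact ⟨_, ⟨j, rfl⟩, x, h⟩
  · rintro _ ⟨i, rfl⟩ r
    obtain ⟨j, x, h⟩ := (hmem r).2 i
    exact ⟨_, ⟨j, rfl⟩, x, h⟩
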